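/- arXiv:1906.09619 — 2 statements merged into one kernel-verified Lean document; each statement's English description precedes it below -/
import Mathlib

section
/- Let G be a group, let π be a unitary representation of G on a complex Hilbert space H, and let Ψ ∈ H be a unit vector whose orbit {π(g)Ψ : g ∈ G} has dense linear span in H. Suppose there is an element A ∈ G with π(A)Ψ = Ψ such that for all g, h ∈ G there exists N with ⟨π(A)^n π(g)Ψ, π(h)Ψ⟩ = ⟨P_Ψ(π(g)Ψ), π(h)Ψ⟩ for all n ≥ N. Then every bounded operator T on H satisfying T π(g) = π(g) T for all g ∈ G is a scalar multiple of the identity; that is, π is irreducible. -/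
open scoped InnerProductSpace
open Filter

/-- The orthogonal projection of `H` onto the line `ℂ • Ψ`, as an operator `H →L[ℂ] H`. -/
noncomputable def projLine {H : Type*} [NormedAddCommGroup H] [InnerProductSpace ℂ H]
    [CompleteSpace H] (Ψ : H) : H →L[ℂ] H :=
  (ℂ ∙ Ψ).subtypeL ∘L Submodule.orthogonalProjectionOnto (ℂ ∙ Ψ)

/-- Abstract form of the main theorem: if the vacuum `Ψ` is cyclic, fixed by `π A`,
and the matrix coefficients eventually factorize through `P_Ψ`, then the representation
is irreducible (the commutant is trivial). -/
theorem irreducible_of_coefficient_factorization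
    {H : Type*} [NormedAddCommGroup H] [InnerProductSpace ℂ H] [CompleteSpace H]
    {G : Type*} [Group G] (π : G →* unitary (H →L[ℂ] H))
    (Ψ : H) (hΨ : ‖Ψ‖ = 1)
    (hcyc : Dense (Submodule.span ℂ (Set.range fun g : G => (π g : H →L[ℂ] H) Ψ) : Set H))
    (A : G) (hfix : (π A : H →L[ℂ] H) Ψ = Ψ)
    (hfact : ∀ g h : G, ∃ N : ℕ, ∀ n ≥ N,
      ⟪((π A : H →L[ℂ] H) ^ n) ((π g : H →L[ℂ] H) Ψ), (π h : H →L[ℂ] H) Ψ⟫_ℂ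
        = ⟪projLine Ψ ((π g : H →L[ℂ] H) Ψ), (π h : H →L[ℂ] H) Ψ⟫_ℂ) :
    ∀ T : H →L[ℂ] H, (∀ g : G, T ∘L (π g : H →L[ℂ] H) = (π g : H →L[ℂ] H) ∘L T) →
      ∃ lam : ℂ, T = lam • (1 : H →L[ℂ] H) := by
  intro T hT
  set U : H →L[ℂ] H := (π A : H →L[ℂ] H) with hU
  have hUn : ∀ (n : ℕ) (x : H), ‖(U ^ n) x‖ = ‖x‖ := by
    intro n x
    have h1 : ((π A ^ n : unitary (H →L[ℂ] H)) : H →L[ℂ] H) = U ^ n := by simp [hU]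
    rw [← h1]
    exact Unitary.norm_map (π A ^ n) x
  have hTfix : ∀ n : ℕ, (U ^ n) (T Ψ) = T Ψ := by
    intro n
    induction n with
    | zero => simp
    | succ k ih =>
      have h2 : U (T Ψ) = T Ψ := by
        have := congrArg (fun S : H →L[ℂ] H => S Ψ) (hT A)
        simp only [ContinuousLinearMap.comp_apply] at this
        rw [hU, ← this, hfix]
      rw [pow_succ, mul_apply_eq_comp, h2, ih]
  -- eventual factorization on the span
  have hev : ∀ h : G, ∀ x ∈ Submodule.span ℂ (Set.range fun g : G => (π g : H →L[ℂ] H) Ψ),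
      ∃ N : ℕ, ∀ n ≥ N, ⟪(U ^ n) x, (π h : H →L[ℂ] H) Ψ⟫_ℂ
        = ⟪projLine Ψ x, (π h : H →L[ℂ] H) Ψ⟫_ℂ := by
    intro h x hx
    induction hx using Submodule.span_induction with
    | mem x hx =>
      obtain ⟨g, rfl⟩ := hx
      exact hfact g h
    | zero => exact ⟨0, fun n _ => by simp⟩
    | add x y _ _ ihx ihy =>
      obtain ⟨N, hN⟩ := ihx
      obtain ⟨M, hM⟩ := ihy
      refine ⟨max N M, fun n hn => ?_⟩
      rw [map_add, map_add, inner_add_left, inner_add_left,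
        hN n (le_trans (le_max_left _ _) hn), hM n (le_trans (le_max_right _ _) hn)]
    | smul c x _ ih =>
      obtain ⟨N, hN⟩ := ih
      refine ⟨N, fun n hn => ?_⟩
      rw [map_smul, map_smul, inner_smul_left, inner_smul_left, hN n hn]
  have hbound : ∀ h : G, ∀ x : H,
      ‖⟪T Ψ - projLine Ψ x, (π h : H →L[ℂ] H) Ψ⟫_ℂ‖
        ≤ ‖T Ψ - x‖ * ‖(π h : H →L[ℂ] H) Ψ‖ := by
    intro h x
    have hclosed : IsClosed {x : H | ‖⟪T Ψ - projLine Ψ x, (π h : H →L[ℂ] H) Ψ⟫_ℂ‖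
        ≤ ‖T Ψ - x‖ * ‖(π h : H →L[ℂ] H) Ψ‖} :=
      isClosed_le (by fun_prop) (by fun_prop)
    refine hclosed.closure_subset_iff.mpr ?_ (hcyc x)
    intro z hz
    obtain ⟨N, hN⟩ := hev h z hz
    have h3 := hN N le_rfl
    rw [Set.mem_ofPred_eq]
    rw [inner_sub_left, ← h3, ← inner_sub_left]
    refine (norm_inner_le_norm _ _).trans (le_of_eq ?_)
    congr 1
    rw [← hUn N (T Ψ - z), map_sub, hTfix]
  have hzero : T Ψ - projLine Ψ (T Ψ) = 0 := by
    refine hcyc.eq_zero_of_inner_left (𝕜 := ℂ) ?_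
    intro v hv
    induction hv using Submodule.span_induction with
    | mem x hx =>
      obtain ⟨g, rfl⟩ := hx
      have := hbound g (T Ψ)
      rw [sub_self, norm_zero, zero_mul] at this
      exact norm_le_zero_iff.mp this
    | zero => simp
    | add x y _ _ ihx ihy => rw [inner_add_right, ihx, ihy, add_zero]
    | smul c x _ ih => rw [inner_smul_right, ih, mul_zero]
  have hmem : T Ψ ∈ (ℂ ∙ Ψ) := by
    rw [sub_eq_zero.mp hzero]
    simp [projLine]
  obtain ⟨lam, hlam⟩ := Submodule.mem_span_singleton.mp hmem
  refine ⟨lam, ?_⟩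
  refine ContinuousLinearMap.ext_on hcyc ?_
  rintro _ ⟨g, rfl⟩
  have := congrArg (fun S : H →L[ℂ] H => S Ψ) (hT g)
  simp only [ContinuousLinearMap.comp_apply] at this
  simp [this, ← hlam]
end

section
/- Let G be a group, let π be a unitary representation of G on a complex Hilbert space H, and let Ψ ∈ H be a unit vector whose orbit {π(g)Ψ : g ∈ G} has dense linear span in H. Suppose there is a sequence (g_n) in G such that π(g_n) converges in the weak operator topology to P_Ψ, the orthogonal projection onto ℂΨ. Then every bounded operator T on H satisfying T π(g) = π(g) T for all g ∈ G is a scalar multiple of the identity; that is, π is irreducible. -/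
open scoped InnerProductSpace
open Filter

/-- Irreducibility criterion: if the rank-one projection onto a cyclic unit vector lies
in the WOT-closure of the image of the group, then the commutant is trivial. -/
theorem irreducible_of_projection_in_weak_closure
    {H : Type*} [NormedAddCommGroup H] [InnerProductSpace ℂ H] [CompleteSpace H]
    {G : Type*} [Group G] (π : G →* unitary (H →L[ℂ] H))
    (Ψ : H) (hΨ : ‖Ψ‖ = 1)
    (hcyc : Dense (Submodule.span ℂ (Set.range fun g : G => (π g : H →L[ℂ] H) Ψ) : Set H))
    (gseq : ℕ → G)
    (hlim : ∀ ξ η : H, Tendsto (fun n : ℕ => ⟪(π (gseq n) : H →L[ℂ] H) ξ, η⟫_ℂ) atTop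
      (nhds ⟪projLine Ψ ξ, η⟫_ℂ)) :
    ∀ T : H →L[ℂ] H, (∀ g : G, T ∘L (π g : H →L[ℂ] H) = (π g : H →L[ℂ] H) ∘L T) →
      ∃ lam : ℂ, T = lam • (1 : H →L[ℂ] H) := by
  intro T hT
  have hP : projLine Ψ Ψ = Ψ := by
    have h := Submodule.starProjection_eq_self_iff.mpr (Submodule.mem_span_singleton_self (R := ℂ) Ψ)
    exact h
  have hTΨ : projLine Ψ (T Ψ) = T Ψ := by
    refine ext_inner_right ℂ fun η => ?_
    have h1 := hlim (T Ψ) η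
    have h2 := hlim Ψ (ContinuousLinearMap.adjoint T η)
    rw [hP, ContinuousLinearMap.adjoint_inner_right] at h2
    refine tendsto_nhds_unique h1 (h2.congr fun n => ?_)
    rw [ContinuousLinearMap.adjoint_inner_right]
    have h3 := congrArg (fun S : H →L[ℂ] H => S Ψ) (hT (gseq n))
    simp only [ContinuousLinearMap.comp_apply] at h3
    rw [h3]
  have hmem : T Ψ ∈ Submodule.span ℂ {Ψ} := by
    rw [← hTΨ]
    exact (Submodule.orthogonalProjectionOnto (Submodule.span ℂ {Ψ}) (T Ψ)).2
  obtain ⟨lam, hlam⟩ := Submodule.mem_span_singleton.mp hmem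
  refine ⟨lam, ContinuousLinearMap.ext_on hcyc ?_⟩
  rintro _ ⟨g, rfl⟩
  have h3 := congrArg (fun S : H →L[ℂ] H => S Ψ) (hT g)
  simp only [ContinuousLinearMap.comp_apply] at h3
  simp only [ContinuousLinearMap.smul_apply, ContinuousLinearMap.one_apply]
  rw [h3, ← hlam, map_smul]
end
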